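/- Suppose the odd density δ_3 of the 3-multipartition function exists and the odd density δ_9 of the 9-multipartition function exists with δ_9 > 0. Then δ_3 > 0. -/

import Mathlib

open Filter

/-- Number of `t`-tuples of partitions with total size `n`, i.e. the
`t`-multipartition function `p_t(n)`; `p_1(n) = p(n)` is the ordinary
partition function. -/
def multipartition (t n : ℕ) : ℕ :=
  ∑ v ∈ Finset.Nat.antidiagonalTuple t n, ∏ i, Fintype.card (Nat.Partition (v i))

/-- Number of `n ≤ x` with `multipartition t n` odd. -/
def oddCount (t x : ℕ) : ℕ :=
  ((Finset.range (x + 1)).filter (fun n => Odd (multipartition t n))).card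

/-- The odd density of the `t`-multipartition function exists and equals `δ`. -/
def hasOddDensity (t : ℕ) (δ : ℝ) : Prop :=
  Tendsto (fun x : ℕ => (oddCount t x : ℝ) / x) atTop (nhds δ)

open PowerSeries

/-- The reflection `x + y√-3 ↦ x - y√-3`, transported along multiplication by a primitive cube root
of unity to pairs `(a, b)` of odd natural numbers representing `(a ± b√-3) / 2`. -/
def eisensteinReflection (p : ℕ × ℕ) : ℕ × ℕ :=
  if p.1 % 4 = p.2 % 4 then
    ((if p.1 ≤ 3 * p.2 then 3 * p.2 - p.1 else p.1 - 3 * p.2) / 2, (p.1 + p.2) / 2)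
  else
    ((p.1 + 3 * p.2) / 2, (if p.1 ≤ p.2 then p.2 - p.1 else p.1 - p.2) / 2)

theorem eisensteinReflection_odd {p : ℕ × ℕ} (h1 : Odd p.1) (h2 : Odd p.2) :
    Odd (eisensteinReflection p).1 ∧ Odd (eisensteinReflection p).2 := by
  obtain ⟨a, b⟩ := p
  simp only [Nat.odd_iff, eisensteinReflection] at *
  split_ifs <;> dsimp only <;> omega

theorem eisensteinReflection_involutive {p : ℕ × ℕ} (h1 : Odd p.1) (h2 : Odd p.2) :
    eisensteinReflection (eisensteinReflection p) = p := by
  obtain ⟨a, b⟩ := p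
  simp only [Nat.odd_iff, eisensteinReflection] at *
  ext <;> split_ifs <;> dsimp only at * <;> omega

theorem eisensteinReflection_norm {p : ℕ × ℕ} (h1 : Odd p.1) (h2 : Odd p.2) :
    (eisensteinReflection p).1 ^ 2 + 3 * (eisensteinReflection p).2 ^ 2 =
      p.1 ^ 2 + 3 * p.2 ^ 2 := by
  have key : ((2 * (eisensteinReflection p).1 : ℕ) : ℤ) ^ 2 +
      3 * ((2 * (eisensteinReflection p).2 : ℕ) : ℤ) ^ 2 = 4 * (p.1 ^ 2 + 3 * p.2 ^ 2) := by
    obtain ⟨a, b⟩ := p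
    simp only [Nat.odd_iff] at h1 h2
    have h : (((2 * (eisensteinReflection (a, b)).1 : ℕ) : ℤ) = 3 * b - a ∨
        ((2 * (eisensteinReflection (a, b)).1 : ℕ) : ℤ) = a - 3 * b) ∧
          ((2 * (eisensteinReflection (a, b)).2 : ℕ) : ℤ) = a + b ∨
        ((2 * (eisensteinReflection (a, b)).1 : ℕ) : ℤ) = a + 3 * b ∧
          (((2 * (eisensteinReflection (a, b)).2 : ℕ) : ℤ) = a - b ∨
          ((2 * (eisensteinReflection (a, b)).2 : ℕ) : ℤ) = b - a) := by
      simp only [eisensteinReflection]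
      split_ifs <;> dsimp only <;> omega
    rcases h with ⟨h | h, h'⟩ | ⟨h, h' | h'⟩ <;> rw [h, h'] <;> ring
  push_cast at key
  zify
  linarith

theorem eisensteinReflection_eq_self_iff {p : ℕ × ℕ} (h1 : Odd p.1) (h2 : Odd p.2) :
    eisensteinReflection p = p ↔ p.1 = p.2 ∨ p.1 = 3 * p.2 := by
  obtain ⟨a, b⟩ := p
  simp only [Nat.odd_iff, eisensteinReflection] at *
  split_ifs <;> simp only [Prod.mk.injEq] <;> omega

/-- The pairs of odd natural numbers `(a, b)` with `a ^ 2 + 3 * b ^ 2 = N`. -/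
def oddRepresentations (N : ℕ) : Finset (ℕ × ℕ) :=
  (Finset.range (N + 1) ×ˢ Finset.range (N + 1)).filter
    fun p => Odd p.1 ∧ Odd p.2 ∧ p.1 ^ 2 + 3 * p.2 ^ 2 = N

theorem mem_oddRepresentations {N : ℕ} {p : ℕ × ℕ} :
    p ∈ oddRepresentations N ↔ Odd p.1 ∧ Odd p.2 ∧ p.1 ^ 2 + 3 * p.2 ^ 2 = N := by
  simp only [oddRepresentations, Finset.mem_filter, Finset.mem_product, Finset.mem_range,
    and_iff_right_iff_imp]
  rintro ⟨-, -, h⟩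
  constructor <;> nlinarith

theorem card_filter_unique {α : Type*} (s : Finset α) (P : α → Prop) [DecidablePred P]
    (h : ∀ x ∈ s, ∀ y ∈ s, P x → P y → x = y) [Decidable (∃ x ∈ s, P x)] :
    (s.filter P).card = if ∃ x ∈ s, P x then 1 else 0 := by
  split_ifs with hx
  · obtain ⟨x, hx, hp⟩ := hx
    rw [Finset.card_eq_one]
    refine ⟨x, Finset.eq_singleton_iff_unique_mem.2 ⟨by simp [hx, hp], fun y hy => ?_⟩⟩
    rw [Finset.mem_filter] at hy
    exact h _ hy.1 _ hx hy.2 hp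
  · rw [Finset.card_eq_zero, Finset.filter_eq_empty_iff]
    exact fun x hxs hp => hx ⟨x, hxs, hp⟩

open Classical in
theorem card_oddRepresentations {m : ℕ} (hm : Odd m) :
    ((oddRepresentations (4 * m)).card : ZMod 2) =
      (if ∃ s, m = s ^ 2 then 1 else 0) + (if ∃ s, m = 3 * s ^ 2 then 1 else 0) := by
  set S := oddRepresentations (4 * m) with hS
  have hfree : ((S.filter fun p => ¬ eisensteinReflection p = p).card : ZMod 2) = 0 := by
    rw [Finset.card_eq_sum_ones, Nat.cast_sum]
    refine Finset.sum_involution (fun p _ => eisensteinReflection p) ?_ ?_ ?_ ?_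
    · intros; decide
    · intro p hp _
      exact (Finset.mem_filter.1 hp).2
    · intro p hp
      simp only [hS, Finset.mem_filter, mem_oddRepresentations] at hp ⊢
      obtain ⟨⟨h1, h2, h3⟩, h4⟩ := hp
      rw [eisensteinReflection_norm h1 h2, eisensteinReflection_involutive h1 h2]
      exact ⟨⟨(eisensteinReflection_odd h1 h2).1, (eisensteinReflection_odd h1 h2).2, h3⟩,
        fun h => h4 h.symm⟩
    · intro p hp
      simp only [hS, Finset.mem_filter, mem_oddRepresentations] at hp
      exact eisensteinReflection_involutive hp.1.1 hp.1.2.1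
  have hfix : S.filter (fun p => eisensteinReflection p = p) =
      S.filter (fun p => p.1 = p.2) ∪ S.filter (fun p => p.1 = 3 * p.2) := by
    rw [← Finset.filter_or]
    refine Finset.filter_congr fun p hp => ?_
    rw [hS, mem_oddRepresentations] at hp
    exact eisensteinReflection_eq_self_iff hp.1 hp.2.1
  have hdisj : Disjoint (S.filter fun p => p.1 = p.2) (S.filter fun p => p.1 = 3 * p.2) := by
    refine Finset.disjoint_filter.2 fun p hp h1 h2 => ?_
    rw [hS, mem_oddRepresentations, Nat.odd_iff] at hp
    omega
  rw [← Finset.card_filter_add_card_filter_not (fun p => eisensteinReflection p = p), Nat.cast_add,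
    hfree, add_zero, hfix, Finset.card_union_of_disjoint hdisj, card_filter_unique,
    card_filter_unique]
  · push_cast
    congr 1
    · refine if_congr ⟨?_, ?_⟩ rfl rfl
      · rintro ⟨⟨a, b⟩, h, rfl : a = b⟩
        rw [hS, mem_oddRepresentations] at h
        exact ⟨a, by linarith [h.2.2]⟩
      · rintro ⟨s, rfl⟩
        have hs : Odd s := (Nat.odd_pow_iff two_ne_zero).1 hm
        exact ⟨(s, s), mem_oddRepresentations.2 ⟨hs, hs, by ring⟩, rfl⟩
    · refine if_congr ⟨?_, ?_⟩ rfl rfl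
      · rintro ⟨⟨a, b⟩, h, rfl : a = 3 * b⟩
        rw [hS, mem_oddRepresentations] at h
        exact ⟨b, by linarith [h.2.2]⟩
      · rintro ⟨s, rfl⟩
        have hs : Odd s := (Nat.odd_pow_iff two_ne_zero).1 (Nat.odd_mul.1 hm).2
        exact ⟨(3 * s, s), mem_oddRepresentations.2 ⟨by simp [Nat.odd_mul, hs]; decide, hs, by ring⟩,
          rfl⟩
  all_goals
    rintro ⟨a, b⟩ hx ⟨c, d⟩ hy h1 h2
    rw [hS, mem_oddRepresentations] at hx hy
    obtain ⟨-, -, hx⟩ := hx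
    obtain ⟨-, -, hy⟩ := hy
    dsimp only at hx hy h1 h2
    have hsq : b ^ 2 = d ^ 2 := by
      rw [h1] at hx
      rw [h2] at hy
      linarith
    rw [h1, h2, Nat.pow_left_injective two_ne_zero hsq]

open Classical in
/-- The power series over `ZMod 2` recording the `n` for which `(c * n + d) / d` is a square. -/
noncomputable def squareSeries (c d : ℕ) : (ZMod 2)⟦X⟧ :=
  PowerSeries.mk fun n => if ∃ a, c * n + d = d * a ^ 2 then 1 else 0

theorem Nat.sq_mod_eight_of_odd {a : ℕ} (h : Odd a) : a ^ 2 % 8 = 1 := by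
  rw [Nat.odd_iff] at h
  have : a % 8 = 1 ∨ a % 8 = 3 ∨ a % 8 = 5 ∨ a % 8 = 7 := by omega
  rcases this with h | h | h | h <;> simp [Nat.pow_mod, h]

theorem Nat.sq_mod_three (a : ℕ) : a % 3 = 0 ∧ a ^ 2 % 3 = 0 ∨ a % 3 ≠ 0 ∧ a ^ 2 % 3 = 1 := by
  have : a % 3 = 0 ∨ a % 3 = 1 ∨ a % 3 = 2 := by omega
  rcases this with h | h | h <;> simp [Nat.pow_mod, h]

open Classical in
theorem coeff_squareSeries_mul {c : ℕ} (hc : c = 8 ∨ c = 24) (n : ℕ) :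
    (squareSeries c 1 * squareSeries c 3).coeff n =
      (if ∃ s, c * n + 4 = 4 * s ^ 2 then 1 else 0) +
      (if ∃ s, c * n + 4 = 12 * s ^ 2 then 1 else 0) := by
  obtain ⟨m, hm, hmo⟩ : ∃ m, c * n + 4 = 4 * m ∧ Odd m := by
    rcases hc with rfl | rfl
    · exact ⟨2 * n + 1, by ring, by simp⟩
    · exact ⟨6 * n + 1, by ring, by simp [Nat.odd_iff]; omega⟩
  have h1 : (squareSeries c 1 * squareSeries c 3).coeff n =
      (((Finset.HasAntidiagonal.antidiagonal n).filter fun p : ℕ × ℕ =>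
        (∃ a, c * p.1 + 1 = a ^ 2) ∧ ∃ b, c * p.2 + 3 = 3 * b ^ 2).card : ZMod 2) := by
    simp only [coeff_mul, squareSeries, coeff_mk, one_mul, Finset.card_filter, Nat.cast_sum,
      Nat.cast_ite, Nat.cast_one, Nat.cast_zero, ← ite_and, mul_ite, mul_one, mul_zero]
    simp only [ite_and]
    refine Finset.sum_congr rfl fun p _ => ?_
    split_ifs <;> rfl
  have h2 : (oddRepresentations (4 * m)).card = ((Finset.HasAntidiagonal.antidiagonal n).filter fun p : ℕ × ℕ =>
        (∃ a, c * p.1 + 1 = a ^ 2) ∧ ∃ b, c * p.2 + 3 = 3 * b ^ 2).card := by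
    have hdiv : ∀ a b : ℕ, Odd a → Odd b → a ^ 2 + 3 * b ^ 2 = 4 * m →
        c * ((a ^ 2 - 1) / c) + 1 = a ^ 2 ∧ c * (3 * (b ^ 2 - 1) / c) + 3 = 3 * b ^ 2 := by
      intro a b ha hb h
      have := Nat.sq_mod_eight_of_odd ha
      have := Nat.sq_mod_eight_of_odd hb
      have := Nat.sq_mod_three a
      rcases hc with rfl | rfl <;> omega
    refine Finset.card_bij (fun p _ => ((p.1 ^ 2 - 1) / c, 3 * (p.2 ^ 2 - 1) / c)) ?_ ?_ ?_
    · rintro ⟨a, b⟩ h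
      rw [mem_oddRepresentations] at h
      obtain ⟨h3, h4⟩ := hdiv a b h.1 h.2.1 h.2.2
      simp only [Finset.mem_filter, Finset.HasAntidiagonal.mem_antidiagonal]
      refine ⟨?_, ⟨a, h3⟩, ⟨b, h4⟩⟩
      have := h.2.2
      dsimp only at this
      rcases hc with rfl | rfl <;> omega
    · rintro ⟨a, b⟩ h ⟨a', b'⟩ h' heq
      rw [mem_oddRepresentations] at h h'
      obtain ⟨h3, h4⟩ := hdiv a b h.1 h.2.1 h.2.2
      obtain ⟨h3', h4'⟩ := hdiv a' b' h'.1 h'.2.1 h'.2.2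
      rw [Prod.mk.injEq] at heq
      dsimp only at heq
      rw [heq.1] at h3
      rw [heq.2] at h4
      have e1 : a ^ 2 = a' ^ 2 := by omega
      have e2 : b ^ 2 = b' ^ 2 := by omega
      rw [(Nat.pow_left_injective two_ne_zero) e1, (Nat.pow_left_injective two_ne_zero) e2]
    · rintro ⟨i, j⟩ h
      simp only [Finset.mem_filter, Finset.HasAntidiagonal.mem_antidiagonal] at h
      obtain ⟨hij, ⟨a, ha⟩, ⟨b, hb⟩⟩ := h
      have hmem : (a, b) ∈ oddRepresentations (4 * m) := by
        rw [mem_oddRepresentations]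
        refine ⟨?_, ?_, ?_⟩
        · rw [← Nat.odd_pow_iff two_ne_zero (n := a), ← ha, Nat.odd_iff]
          rcases hc with rfl | rfl <;> omega
        · rw [← Nat.odd_pow_iff two_ne_zero (n := b), Nat.odd_iff]
          rcases hc with rfl | rfl <;> omega
        · dsimp only
          rw [← hm, ← ha, ← hb, ← hij]
          ring
      refine ⟨(a, b), hmem, ?_⟩
      rw [Prod.mk.injEq]
      dsimp only
      rcases hc with rfl | rfl <;> omega
  rw [h1, ← h2, card_oddRepresentations hmo, hm]
  congr 1 <;> refine if_congr (exists_congr fun s => ?_) rfl rfl <;> omega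

theorem squareSeries_mul_left (k : ℕ) (hk : k ≠ 0) (c d : ℕ) :
    squareSeries (k * c) (k * d) = squareSeries c d := by
  classical
  ext n
  simp only [squareSeries, coeff_mk]
  refine if_congr (exists_congr fun a => ?_) rfl rfl
  rw [mul_assoc, mul_assoc, ← mul_add]
  exact Nat.mul_right_inj hk

theorem expand_three_squareSeries :
    PowerSeries.expand 3 three_ne_zero (squareSeries 8 1) = squareSeries 8 3 := by
  classical
  ext n
  simp only [coeff_expand, squareSeries, coeff_mk]
  by_cases h : 3 ∣ n
  · obtain ⟨k, rfl⟩ := h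
    simp only [dvd_mul_right, if_true, Nat.mul_div_cancel_left k three_pos]
    exact if_congr (exists_congr fun a => by omega) rfl rfl
  · rw [if_neg h, if_neg]
    rintro ⟨a, ha⟩
    omega

/-- Raising to the fourth power in characteristic two. -/
theorem pow_four_eq_expand (f : (ZMod 2)⟦X⟧) : f ^ 4 = PowerSeries.expand 4 four_ne_zero f := by
  have h : ∀ g : (ZMod 2)⟦X⟧, g ^ 2 = PowerSeries.expand 2 two_ne_zero g := by
    intro g
    have := MvPowerSeries.map_frobenius_expand (p := 2) (hp := two_ne_zero) (f := g)
    rw [ZMod.frobenius_zmod, MvPowerSeries.map_id] at this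
    exact this.symm
  rw [show f ^ 4 = (f ^ 2) ^ 2 by ring, h, h, ← PowerSeries.expand_mul]

open Classical in
theorem coeff_expand_four_squareSeries {c d : ℕ} (hc : c = 8 ∨ c = 24) (hd : d = 1 ∨ d = 3)
    (n : ℕ) : (PowerSeries.expand 4 four_ne_zero (squareSeries c d)).coeff n =
      if ∃ s, c * n + 4 * d = 4 * d * s ^ 2 then 1 else 0 := by
  simp only [coeff_expand, squareSeries, coeff_mk]
  by_cases h : 4 ∣ n
  · obtain ⟨k, rfl⟩ := h
    rw [if_pos (dvd_mul_right 4 k), Nat.mul_div_cancel_left k four_pos]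
    refine if_congr (exists_congr fun s => ?_) rfl rfl
    rcases hd with rfl | rfl <;> rcases hc with rfl | rfl <;> omega
  · rw [if_neg h, if_neg]
    rintro ⟨s, hs⟩
    have hodd : Odd s := by
      rw [← Nat.odd_pow_iff two_ne_zero (n := s), Nat.odd_iff]
      rcases hd with rfl | rfl <;> rcases hc with rfl | rfl <;> omega
    have := Nat.sq_mod_eight_of_odd hodd
    rcases hd with rfl | rfl <;> rcases hc with rfl | rfl <;> omega

theorem squareSeries_mul_eq_pow_four :
    squareSeries 24 1 * squareSeries 8 1 = squareSeries 24 1 ^ 4 := by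
  rw [pow_four_eq_expand, ← squareSeries_mul_left 3 three_ne_zero 8 1]
  ext n
  rw [coeff_squareSeries_mul (Or.inr rfl), if_neg (c := (∃ s, 24 * n + 4 = 12 * s ^ 2)), add_zero,
    coeff_expand_four_squareSeries (Or.inr rfl) (Or.inl rfl)]
  rintro ⟨s, hs⟩
  omega

theorem squareSeries_mul_expand_three :
    squareSeries 8 1 * PowerSeries.expand 3 three_ne_zero (squareSeries 8 1) =
      squareSeries 8 1 ^ 4 +
        X * PowerSeries.expand 3 three_ne_zero (squareSeries 8 1) ^ 4 := by
  rw [pow_four_eq_expand, pow_four_eq_expand, expand_three_squareSeries]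
  ext n
  rw [coeff_squareSeries_mul (Or.inl rfl), map_add,
    coeff_expand_four_squareSeries (Or.inl rfl) (Or.inl rfl)]
  congr 1
  cases n with
  | zero =>
    rw [coeff_zero_X_mul, if_neg]
    rintro ⟨s, hs⟩
    omega
  | succ n =>
    rw [coeff_succ_X_mul, coeff_expand_four_squareSeries (Or.inl rfl) (Or.inr rfl)]
    rfl

theorem squareSeries_dissection :
    squareSeries 8 1 = PowerSeries.expand 3 three_ne_zero (squareSeries 24 1) +
      X * PowerSeries.expand 3 three_ne_zero
        (PowerSeries.expand 3 three_ne_zero (squareSeries 8 1)) := by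
  classical
  rw [expand_three_squareSeries]
  ext n
  obtain ⟨k, hk⟩ : ∃ k, n = 3 * k ∨ n = 3 * k + 1 ∨ n = 3 * k + 2 := ⟨n / 3, by omega⟩
  rcases hk with rfl | rfl | rfl
  · rw [map_add, coeff_expand_mul]
    have : (X * PowerSeries.expand 3 three_ne_zero (squareSeries 8 3)).coeff (3 * k) = 0 := by
      cases k with
      | zero => simp
      | succ k =>
        rw [show 3 * (k + 1) = 3 * k + 2 + 1 by ring, coeff_succ_X_mul, coeff_expand_of_not_dvd]
        omega
    rw [this, add_zero]
    simp only [squareSeries, coeff_mk]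
    exact if_congr (exists_congr fun a => by omega) rfl rfl
  · rw [map_add, coeff_expand_of_not_dvd _ _ _ (by omega), zero_add, coeff_succ_X_mul,
      coeff_expand_mul]
    simp only [squareSeries, coeff_mk]
    refine if_congr ⟨?_, ?_⟩ rfl rfl
    · rintro ⟨a, ha⟩
      have := Nat.sq_mod_three a
      obtain ⟨b, rfl⟩ : 3 ∣ a := by omega
      exact ⟨b, by nlinarith⟩
    · rintro ⟨a, ha⟩
      exact ⟨3 * a, by nlinarith⟩
  · rw [map_add, coeff_expand_of_not_dvd _ _ _ (by omega), zero_add, coeff_succ_X_mul,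
      coeff_expand_of_not_dvd _ _ _ (by omega)]
    simp only [squareSeries, coeff_mk]
    rw [if_neg]
    rintro ⟨a, ha⟩
    have := Nat.sq_mod_three a
    omega

theorem pentagonalSeries_eq_squareSeries : pentagonalSeries (ZMod 2) = squareSeries 24 1 := by
  ext n
  simp only [squareSeries, coeff_mk]
  have key : (∃ a, 24 * n + 1 = 1 * a ^ 2) ↔ n ∈ Set.range pentagonal := by
    constructor
    · rintro ⟨a, ha⟩
      obtain ⟨k, hk⟩ : ∃ k : ℤ, (6 * k - 1) ^ 2 = (a : ℤ) ^ 2 := by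
        have h3 := Nat.sq_mod_three a
        have h2 : Odd a := by
          rw [← Nat.odd_pow_iff two_ne_zero (n := a), Nat.odd_iff]
          omega
        rw [Nat.odd_iff] at h2
        obtain h | h : a % 6 = 1 ∨ a % 6 = 5 := by omega
        · exact ⟨-(a / 6), by rw [← neg_sq]; congr 1; omega⟩
        · exact ⟨a / 6 + 1, by congr 1; omega⟩
      refine ⟨k, ?_⟩
      have := two_mul_natCast_pentagonal k
      zify at ha ⊢
      nlinarith
    · rintro ⟨k, rfl⟩
      refine ⟨(6 * k - 1).natAbs, ?_⟩
      have := two_mul_natCast_pentagonal k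
      zify
      rw [sq_abs]
      nlinarith
  split_ifs with h
  · obtain ⟨k, rfl⟩ := key.1 h
    rw [coeff_pentagonalSeries_pentagonal]
    rcases Int.even_or_odd k with hk | hk
    · simp [Int.negOnePow_even k hk]
    · simp [Int.negOnePow_odd k hk]
  · exact coeff_pentagonalSeries_eq_zero _ (mt key.2 h)

/-- The generating function of the partition function. -/
noncomputable def partitionSeries (R : Type*) [CommSemiring R] : R⟦X⟧ :=
  PowerSeries.mk fun n => (Fintype.card (Nat.Partition n) : R)

open scoped PowerSeries.WithPiTopology in
theorem partitionSeries_mul_pentagonalSeries (R : Type*) [CommRing R] :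
    partitionSeries R * pentagonalSeries R = 1 := by
  let : TopologicalSpace R := ⊥
  have : DiscreteTopology R := ⟨rfl⟩
  have h := (Nat.Partition.hasProd_powerSeriesMk_card_restricted R (fun _ => True)).mul
    (WithPiTopology.hasProd_one_sub_X_pow R)
  have hp : (PowerSeries.mk fun n => ((Nat.Partition.restricted n fun _ => True).card : R)) =
      partitionSeries R := by
    simp [Nat.Partition.restricted, partitionSeries]
  rw [hp] at h
  refine h.unique ?_
  convert hasProd_one with i
  simp only [if_true, pow_mul]
  exact WithPiTopology.tsum_pow_mul_one_sub_of_constantCoeff_eq_zero (by simp)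

theorem natCast_multipartition (R : Type*) [CommSemiring R] (t n : ℕ) :
    (multipartition t n : R) = (partitionSeries R ^ t).coeff n := by
  have h : partitionSeries R ^ t = ∏ _i : Fin t, partitionSeries R := by simp
  rw [h, coeff_prod, multipartition, Nat.cast_sum]
  refine Finset.sum_bij' (fun v _ => Finsupp.equivFunOnFinite.symm v) (fun l _ => ⇑l) ?_ ?_ ?_ ?_ ?_
  · intro v hv
    simpa [Finset.Nat.mem_antidiagonalTuple] using hv
  · intro l hl
    simpa [Finset.Nat.mem_antidiagonalTuple] using hl
  · intro v _
    rfl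
  · intro l _
    ext
    rfl
  · intro v _
    simp [partitionSeries]

theorem squareSeries_eq_pow_three : squareSeries 8 1 = squareSeries 24 1 ^ 3 := by
  have h := partitionSeries_mul_pentagonalSeries (ZMod 2)
  rw [pentagonalSeries_eq_squareSeries] at h
  apply mul_left_cancel₀ (right_ne_zero_of_mul_eq_one h)
  rw [squareSeries_mul_eq_pow_four]
  ring

theorem partitionSeries_pow_three_mul :
    partitionSeries (ZMod 2) ^ 3 * squareSeries 8 1 = 1 := by
  rw [squareSeries_eq_pow_three, ← mul_pow, ← pentagonalSeries_eq_squareSeries,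
    partitionSeries_mul_pentagonalSeries, one_pow]

theorem X_mul_partitionSeries_pow_three :
    ∃ U V : (ZMod 2)⟦X⟧, X * partitionSeries (ZMod 2) ^ 3 =
      PowerSeries.expand 3 three_ne_zero (partitionSeries (ZMod 2) ^ 9 +
        PowerSeries.expand 3 three_ne_zero (partitionSeries (ZMod 2) ^ 3)) +
      X * PowerSeries.expand 3 three_ne_zero U + X ^ 2 * PowerSeries.expand 3 three_ne_zero V := by
  set e := PowerSeries.expand (R := ZMod 2) 3 three_ne_zero with he
  have h2 : (2 : (ZMod 2)⟦X⟧) = 0 := by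
    rw [← map_ofNat (C (R := ZMod 2)) 2, show (OfNat.ofNat 2 : ZMod 2) = 0 from rfl, map_zero]
  rw [show partitionSeries (ZMod 2) ^ 9 = (partitionSeries (ZMod 2) ^ 3) ^ 3 by ring]
  have hQ := partitionSeries_pow_three_mul
  generalize partitionSeries (ZMod 2) ^ 3 = Q at *
  have hE := squareSeries_eq_pow_three
  have hD := squareSeries_dissection
  have hT := squareSeries_mul_expand_three
  rw [← he] at hD hT
  generalize squareSeries 8 1 = T at *
  generalize squareSeries 24 1 = E at *
  have hQ3 : e Q * e T = 1 := by rw [← map_mul, hQ, map_one]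
  have hQ9 : e (e Q) * e (e T) = 1 := by rw [← map_mul, hQ3, map_one]
  have hE3 : e T = e E ^ 3 := by rw [hE, map_pow]
  have hT3 : e T * e (e T) = e T ^ 4 + X ^ 3 * e (e T) ^ 4 := by
    have := congrArg e hT
    simpa [he, PowerSeries.expand_X] using this
  refine ⟨E ^ 2 * e T * Q ^ 4, E * e T ^ 2 * Q ^ 4, ?_⟩
  simp only [map_add, map_mul, map_pow]
  generalize e (e T) = T9 at *
  generalize e (e Q) = Q9 at *
  generalize e T = T3 at *
  generalize e Q = Q3 at *
  generalize e E = E3 at *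
  have hZ : T3 + X ^ 3 * T9 ^ 3 = T3 ^ 4 * Q9 := by
    linear_combination (-T3 + X ^ 3 * T9 ^ 3) * hQ9 + Q9 * hT3 + X ^ 3 * T9 ^ 3 * h2
  have hcube : T ^ 3 * Q3 ^ 4 =
      Q9 + X * (E3 ^ 2 * T9 * Q3 ^ 4) + X ^ 2 * (E3 * T9 ^ 2 * Q3 ^ 4) := by
    rw [hD]
    linear_combination -Q3 ^ 4 * hE3 + Q3 ^ 4 * hZ +
      Q9 * (1 + Q3 * T3 + (Q3 * T3) ^ 2 + (Q3 * T3) ^ 3) * hQ3 +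
      (X * E3 ^ 2 * T9 + X ^ 2 * E3 * T9 ^ 2) * Q3 ^ 4 * h2
  have hinv : X * Q = Q3 ^ 3 + T ^ 3 * Q3 ^ 4 := by
    linear_combination -Q * Q3 ^ 4 * hT -
      X * Q * (1 + Q3 * T3 + (Q3 * T3) ^ 2 + (Q3 * T3) ^ 3) * hQ3 +
      Q3 ^ 3 * (Q * T * hQ3 + hQ) - T ^ 3 * Q3 ^ 4 * hQ - T ^ 3 * Q3 ^ 4 * h2
  rw [hinv, hcube]
  ring

theorem natCast_multipartition_nine (n : ℕ) :
    (multipartition 9 n : ZMod 2) = (X * partitionSeries (ZMod 2) ^ 3).coeff (3 * n) +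
      (PowerSeries.expand 3 three_ne_zero (partitionSeries (ZMod 2) ^ 3)).coeff n := by
  obtain ⟨U, V, h⟩ := X_mul_partitionSeries_pow_three
  have hU : (X * PowerSeries.expand 3 three_ne_zero U).coeff (3 * n) = 0 := by
    cases n with
    | zero => simp
    | succ n =>
      rw [show 3 * (n + 1) = 3 * n + 2 + 1 by ring, coeff_succ_X_mul, coeff_expand_of_not_dvd]
      omega
  have hV : (X ^ 2 * PowerSeries.expand 3 three_ne_zero V).coeff (3 * n) = 0 := by
    cases n with
    | zero => simp
    | succ n =>
      rw [show 3 * (n + 1) = 3 * n + 1 + 2 by ring, coeff_X_pow_mul, coeff_expand_of_not_dvd]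
      omega
  rw [h, map_add, map_add, hU, hV, add_zero, add_zero, coeff_expand_mul, map_add, add_assoc,
    CharTwo.add_self_eq_zero, add_zero, natCast_multipartition]

theorem odd_multipartition_three_of_nine {n : ℕ} (h : Odd (multipartition 9 n)) :
    (∃ m, m + 1 = 3 * n ∧ Odd (multipartition 3 m)) ∨
      ∃ k, n = 3 * k ∧ Odd (multipartition 3 k) := by
  by_contra! hcon
  obtain ⟨h1, h2⟩ := hcon
  have hz : ∀ m, ¬ Odd (multipartition 3 m) → (partitionSeries (ZMod 2) ^ 3).coeff m = 0 := by
    intro m hm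
    rw [← natCast_multipartition, ZMod.natCast_eq_zero_iff_even]
    exact Nat.not_odd_iff_even.1 hm
  rw [← ZMod.natCast_eq_one_iff_odd, natCast_multipartition_nine, coeff_expand] at h
  have hX : (X * partitionSeries (ZMod 2) ^ 3).coeff (3 * n) = 0 := by
    cases n with
    | zero => simp
    | succ n =>
      rw [show 3 * (n + 1) = 3 * n + 2 + 1 by ring, coeff_succ_X_mul]
      exact hz _ (h1 _ (by ring))
  rw [hX, zero_add] at h
  split_ifs at h with hn
  · rw [hz _ (h2 _ (Nat.mul_div_cancel' hn).symm)] at h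
    exact zero_ne_one h
  · exact zero_ne_one h

theorem oddCount_nine_le (x : ℕ) : oddCount 9 x ≤ oddCount 3 (3 * x) + oddCount 3 x := by
  unfold oddCount
  refine (Finset.card_le_card ?_).trans ((Finset.card_union_le _ _).trans
    (add_le_add (Finset.card_image_le (f := fun m => (m + 1) / 3))
      (Finset.card_image_le (f := fun k => 3 * k))))
  intro n hn
  simp only [Finset.mem_filter, Finset.mem_range, Finset.mem_union, Finset.mem_image] at hn ⊢
  rcases odd_multipartition_three_of_nine hn.2 with ⟨m, hm, ho⟩ | ⟨k, hk, ho⟩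
  · exact Or.inl ⟨m, ⟨by omega, ho⟩, by omega⟩
  · exact Or.inr ⟨k, ⟨by omega, ho⟩, hk.symm⟩

/-- If `δ_3` and `δ_9` exist and `δ_9 > 0`, then `δ_3 > 0`. -/
theorem delta_three_pos_of_delta_nine_pos (δ₃ δ₉ : ℝ)
    (h3 : hasOddDensity 3 δ₃) (h9 : hasOddDensity 9 δ₉) (h9pos : 0 < δ₉) :
    0 < δ₃ := by
  have hsub : Tendsto (fun x : ℕ => (oddCount 3 (3 * x) : ℝ) / ((3 * x : ℕ) : ℝ)) atTop
      (nhds δ₃) :=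
    Tendsto.comp h3 (tendsto_id.const_mul_atTop' three_pos)
  have hlim := (hsub.const_mul 3).add h3
  have hle : δ₉ ≤ 3 * δ₃ + δ₃ := by
    refine le_of_tendsto_of_tendsto' h9 hlim fun x => ?_
    have h : (oddCount 9 x : ℝ) ≤ oddCount 3 (3 * x) + oddCount 3 x := by
      exact_mod_cast oddCount_nine_le x
    have e : 3 * ((oddCount 3 (3 * x) : ℝ) / ((3 * x : ℕ) : ℝ)) + (oddCount 3 x : ℝ) / x =
        (oddCount 3 (3 * x) + oddCount 3 x) / x := by
      push_cast
      rw [← mul_div_assoc, mul_div_mul_left _ _ three_ne_zero, add_div]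
    rw [e]
    gcongr
  linarith
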